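/- arXiv:2602.03565 — 10 statements merged into one kernel-verified Lean document; each statement's English description precedes it below -/
import Mathlib

section
/- Unicity of the canonical representation of symbolic vectors: if sv and sv' are two canonical symbolic vectors, then uf(sv) = uf(sv') if and only if sv = sv'. -/
variable {n : ℕ}

/-- A vector is an element of ℕ^n. -/
abbrev Vec (n : ℕ) := Fin n → ℕ

/-- Componentwise (non-strict partial) order on vectors. -/
def vle (q q' : Vec n) : Prop := ∀ p, q p ≤ q' p

/-- Componentwise maximum (join) of two vectors. -/
def vsup (q q' : Vec n) : Vec n := fun p => max (q p) (q' p)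

/-- A symbolic vector is a pair of sets of vectors. -/
abbrev SymVec (n : ℕ) := Set (Vec n) × Set (Vec n)

/-- The underlying set of vectors of a symbolic vector. -/
def uf (sv : SymVec n) : Set (Vec n) :=
  {q | (∀ qa ∈ sv.1, vle qa q) ∧ ∀ qb ∈ sv.2, ¬ vle qb q}

/-- The underlying set of vectors of a set of symbolic vectors. -/
def ufSvs (S : Set (SymVec n)) : Set (Vec n) := ⋃ sv ∈ S, uf sv

/-- Difference of two symbolic vectors. -/
def svDiff (sv sv' : SymVec n) : Set (SymVec n) :=
  {x | ∃ qc ∈ sv'.1, x = (sv.1, sv.2 ∪ {qc})} ∪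
  {x | ∃ qd ∈ sv'.2, x = (sv.1 ∪ sv'.1 ∪ {qd}, sv.2)}

/-- Canonicity of a symbolic vector. -/
def Canonical (sv : SymVec n) : Prop :=
  ∃ qa, sv.1 = {qa} ∧
    ((∀ qb ∈ sv.2, ¬ vle qb qa) ∨ sv = ({0}, {0})) ∧
    (∀ qb ∈ sv.2, ∀ qb' ∈ sv.2, qb ≠ qb' → ¬ vle qb qb' ∧ ¬ vle qb' qb) ∧
    (∀ qb ∈ sv.2, ∀ p, qa p ≤ qb p)

/-- Lexicographic (total) order on vectors. -/
def lexLe (q q' : Vec n) : Prop :=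
  q = q' ∨ ∃ p, q p < q' p ∧ ∀ p', p' < p → q p' = q' p'

/-- Overlap relation (core form, on the components of canonical symbolic vectors). -/
def OverlapCore (qa : Vec n) (b : Set (Vec n)) (qc : Vec n) (d : Set (Vec n)) : Prop :=
  (∀ qb ∈ b, ¬ vle qb (vsup qa qc) ∨ (vle (vsup qa qc) qb ∧ vsup qa qc ≠ qb)) ∧
  (∀ qd ∈ d, ¬ vle qd (vsup qa qc) ∨ (vle (vsup qa qc) qd ∧ vsup qa qc ≠ qd))

/-- Overlap relation on symbolic vectors. -/
def Overlap (sv sv' : SymVec n) : Prop :=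
  ∃ qa qc, sv.1 = {qa} ∧ sv'.1 = {qc} ∧ OverlapCore qa sv.2 qc sv'.2

/-- Gap relation (core form). -/
def GapCore (qa : Vec n) (b : Set (Vec n)) (qc : Vec n) (d : Set (Vec n)) : Prop :=
  (∃ qb ∈ b, vle qb (vsup qa qc) ∧ qb ≠ vsup qa qc) ∨
  (∃ qd ∈ d, vle qd (vsup qa qc) ∧ qd ≠ vsup qa qc) ∨
  (vsup qa qc ∈ b ∧ vsup qa qc ∈ d)

/-- Gap relation on symbolic vectors. -/
def Gap (sv sv' : SymVec n) : Prop :=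
  ∃ qa qc, sv.1 = {qa} ∧ sv'.1 = {qc} ∧ GapCore qa sv.2 qc sv'.2

/-- Mergeable relation (core form, nonempty case). -/
def MergeableCore (qa : Vec n) (b : Set (Vec n)) (qc : Vec n) (d : Set (Vec n)) : Prop :=
  (vle qa qc ∧ ∀ qb ∈ b, vle qc qb ∨ ∃ qd ∈ d, vle qd (vsup qb qc)) ∨
  (vle qc qa ∧ ∀ qd ∈ d, vle qa qd ∨ ∃ qb ∈ b, vle qb (vsup qd qa))

/-- Mergeable relation on symbolic vectors. -/
def Mergeable (sv sv' : SymVec n) : Prop :=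
  uf sv = ∅ ∨ uf sv' = ∅ ∨
  ∃ qa qc, sv.1 = {qa} ∧ sv'.1 = {qc} ∧ MergeableCore qa sv.2 qc sv'.2

/-- Shareable relation (core form, nonempty case). -/
def ShareableCore (qa : Vec n) (b : Set (Vec n)) (qc : Vec n) (d : Set (Vec n)) : Prop :=
  (lexLe qa qc ∧ (∀ qb ∈ b, ¬ (vle qb (vsup qa qc) ∧ qb ≠ vsup qa qc)) ∧
    (∀ qd ∈ d, ¬ vle qd (vsup qa qc))) ∨
  (lexLe qc qa ∧ qc ≠ qa ∧ (∀ qd ∈ d, ¬ (vle qd (vsup qa qc) ∧ qd ≠ vsup qa qc)) ∧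
    (∀ qb ∈ b, ¬ vle qb (vsup qa qc)))

/-- Shareable relation on symbolic vectors. -/
def Shareable (sv sv' : SymVec n) : Prop :=
  uf sv = ∅ ∨ uf sv' = ∅ ∨
  ∃ qa qc, sv.1 = {qa} ∧ sv'.1 = {qc} ∧ ShareableCore qa sv.2 qc sv'.2

/-- Canonicity of a (finite) symbolic vector set. -/
def CanonicalSVS (svs : Set (SymVec n)) : Prop :=
  (∀ sv ∈ svs, Canonical sv) ∧
  ((∃ sv ∈ svs, uf sv ≠ ∅) ∨ svs = ∅) ∧
  (∀ sv ∈ svs, ∀ sv' ∈ svs, sv ≠ sv' → ¬ Shareable sv sv')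

theorem vle_antisymm {q q' : Vec n} (h : vle q q') (h' : vle q' q) : q = q' :=
  le_antisymm (α := Vec n) h h'

theorem vle_trans {q₁ q₂ q₃ : Vec n} (h : vle q₁ q₂) (h' : vle q₂ q₃) : vle q₁ q₃ :=
  le_trans (α := Vec n) h h'

/-- If the underlying sets agree over a common lower bound `qa`, then every forbidden vector of
one symbolic vector dominates a forbidden vector of the other. -/
theorem exists_vle_of_uf_eq {qa : Vec n} {b b' : Set (Vec n)}
    (huf : uf ({qa}, b) = uf ({qa}, b')) {q : Vec n} (hq : q ∈ b) (hqa : vle qa q) :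
    ∃ q' ∈ b', vle q' q := by
  by_contra! hb'
  have hmem : q ∈ uf ({qa}, b') := ⟨by rintro _ rfl; exact hqa, hb'⟩
  rw [← huf] at hmem
  exact hmem.2 q hq fun _ => le_rfl

/-- An antichain `b` is contained in `b'` as soon as each dominates the other elementwise. -/
theorem subset_of_forall_exists_vle {b b' : Set (Vec n)}
    (hanti : ∀ q ∈ b, ∀ q' ∈ b, q ≠ q' → ¬ vle q q' ∧ ¬ vle q' q)
    (h : ∀ q ∈ b, ∃ q' ∈ b', vle q' q) (h' : ∀ q ∈ b', ∃ q' ∈ b, vle q' q) : b ⊆ b' := by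
  intro q hq
  obtain ⟨q', hq', hle⟩ := h q hq
  obtain ⟨q'', hq'', hle'⟩ := h' q' hq'
  have heq : q'' = q := by
    by_contra hne
    exact (hanti q'' hq'' q hq hne).1 (vle_trans hle' hle)
  subst heq
  rwa [vle_antisymm hle' hle]

theorem mem_uf_of_forall_not_vle {qa : Vec n} {b : Set (Vec n)}
    (h : ∀ qb ∈ b, ¬ vle qb qa) : qa ∈ uf ({qa}, b) :=
  ⟨by rintro _ rfl p; exact le_rfl, h⟩

theorem uf_zero_zero : uf (({0}, {0}) : SymVec n) = ∅ :=
  Set.eq_empty_of_forall_notMem fun _ hq => hq.2 0 rfl (hq.1 0 rfl)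

/-- Unicity of the canonical representation of symbolic vectors. -/
theorem canonical_unique (sv sv' : SymVec n)
    (h : Canonical sv) (h' : Canonical sv') :
    uf sv = uf sv' ↔ sv = sv' := by
  refine ⟨fun huf => ?_, fun heq => heq ▸ rfl⟩
  obtain ⟨a, b⟩ := sv
  obtain ⟨a', b'⟩ := sv'
  obtain ⟨qa, rfl : a = {qa}, hne, hanti, hle⟩ := h
  obtain ⟨qa', rfl : a' = {qa'}, hne', hanti', hle'⟩ := h'
  rcases hne with hne | hzero <;> rcases hne' with hne' | hzero'
  · have hmem := mem_uf_of_forall_not_vle hne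
    have hmem' := mem_uf_of_forall_not_vle hne'
    rw [huf] at hmem
    rw [← huf] at hmem'
    obtain rfl : qa = qa' := vle_antisymm (hmem'.1 qa rfl) (hmem.1 qa' rfl)
    have hdom : ∀ q ∈ b, ∃ q' ∈ b', vle q' q := fun q hq =>
      exists_vle_of_uf_eq huf hq (hle q hq)
    have hdom' : ∀ q ∈ b', ∃ q' ∈ b, vle q' q := fun q hq =>
      exists_vle_of_uf_eq huf.symm hq (hle' q hq)
    have hb : b = b' := (subset_of_forall_exists_vle hanti hdom hdom').antisymm
      (subset_of_forall_exists_vle hanti' hdom' hdom)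
    rw [hb]
  · have hmem := mem_uf_of_forall_not_vle hne
    rw [huf, hzero', uf_zero_zero] at hmem
    exact hmem.elim
  · have hmem := mem_uf_of_forall_not_vle hne'
    rw [← huf, hzero, uf_zero_zero] at hmem
    exact hmem.elim
  · rw [hzero, hzero']
end

section
/- For any symbolic vectors sv = (a, b) and sv' = (c, d), the underlying set of the difference of symbolic vectors equals the set difference of the underlying sets: uf_svs(sv \_sv sv') = uf(sv) \ uf(sv'). -/
variable {n : ℕ}

/-- The underlying set of the difference of symbolic vectors equals the set
difference of their underlying sets. -/
theorem uf_diff (sv sv' : SymVec n) :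
    ufSvs (svDiff sv sv') = uf sv \ uf sv' := by
  ext q
  simp only [ufSvs, Set.mem_iUnion, exists_prop, Set.mem_sdiff]
  constructor
  · rintro ⟨x, ⟨qc, hqc, rfl⟩ | ⟨qd, hqd, rfl⟩, hge, hnge⟩
    · exact ⟨⟨hge, fun qb hqb => hnge qb (Or.inl hqb)⟩,
        fun h => hnge qc (Or.inr rfl) (h.1 qc hqc)⟩
    · exact ⟨⟨fun qa hqa => hge qa (Or.inl (Or.inl hqa)), hnge⟩,
        fun h => h.2 qd hqd (hge qd (Or.inr rfl))⟩
  · rintro ⟨⟨hge, hnge⟩, hq⟩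
    by_cases hc : ∀ qc ∈ sv'.1, vle qc q
    · obtain ⟨qd, hqd, hle⟩ : ∃ qd ∈ sv'.2, vle qd q := by
        by_contra! h
        exact hq ⟨hc, h⟩
      refine ⟨_, Or.inr ⟨qd, hqd, rfl⟩, ?_, hnge⟩
      rintro qa ((hqa | hqa) | rfl)
      exacts [hge qa hqa, hc qa hqa, hle]
    · push Not at hc
      obtain ⟨qc, hqc, hnle⟩ := hc
      refine ⟨_, Or.inl ⟨qc, hqc, rfl⟩, hge, ?_⟩
      rintro qb (hqb | rfl)
      exacts [hnge qb hqb, hnle]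
end

section
/- For any sets svs and svs' of symbolic vectors, the underlying set of their symbolic intersection equals the intersection of their underlying sets: uf_svs(svs ∩_svs svs') = uf_svs(svs) ∩ uf_svs(svs'), where svs ∩_svs svs' = {(a ∪ c, b ∪ d) : (a, b) ∈ svs, (c, d) ∈ svs'}. -/
variable {n : ℕ}

/-- Intersection of two symbolic vector sets. -/
def svsInter (svs svs' : Set (SymVec n)) : Set (SymVec n) :=
  {x | ∃ sv ∈ svs, ∃ sv' ∈ svs', x = (sv.1 ∪ sv'.1, sv.2 ∪ sv'.2)}

/-- The underlying set of the componentwise union of two symbolic vectors is the intersection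
of their underlying sets. -/
theorem uf_union (sv sv' : SymVec n) :
    uf (sv.1 ∪ sv'.1, sv.2 ∪ sv'.2) = uf sv ∩ uf sv' := by
  ext q
  simp only [uf, Set.mem_ofPred_eq, Set.mem_inter_iff, Set.mem_union, or_imp, forall_and]
  exact and_and_and_comm

/-- The underlying set of the symbolic intersection of two symbolic vector sets
equals the intersection of their underlying sets. -/
theorem ufSvs_inter (svs svs' : Set (SymVec n)) :
    ufSvs (svsInter svs svs') = ufSvs svs ∩ ufSvs svs' := by
  ext q
  simp only [ufSvs, svsInter, Set.mem_iUnion, Set.mem_inter_iff, exists_prop]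
  constructor
  · rintro ⟨_, ⟨sv, hsv, sv', hsv', rfl⟩, hq⟩
    rw [uf_union] at hq
    exact ⟨⟨sv, hsv, hq.1⟩, ⟨sv', hsv', hq.2⟩⟩
  · rintro ⟨⟨sv, hsv, hq⟩, ⟨sv', hsv', hq'⟩⟩
    refine ⟨_, ⟨sv, hsv, sv', hsv', rfl⟩, ?_⟩
    rw [uf_union]
    exact ⟨hq, hq'⟩
end

section
/- If sv and sv' are canonical symbolic vectors and mergeable(sv, sv') holds, then there exists a single symbolic vector sv'' whose underlying set equals the union of the two underlying sets: uf(sv'') = uf(sv) ∪ uf(sv'). -/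
variable {n : ℕ}

theorem vle_trans_s7 {x y z : Vec n} (hxy : vle x y) (hyz : vle y z) : vle x z :=
  fun p => (hxy p).trans (hyz p)

theorem vsup_vle {x y z : Vec n} (hx : vle x z) (hy : vle y z) : vle (vsup x y) z :=
  fun p => max_le (hx p) (hy p)

/-- If the lower bounds are comparable and each upper bound of the lower symbolic vector is
compatible with the other one, the union is represented by the smaller lower bound together with
all vectors outside the union that lie above it. -/
theorem exists_uf_eq_union_of_vle {qa qc : Vec n} {b d : Set (Vec n)} (hac : vle qa qc)
    (hb : ∀ qb ∈ b, vle qc qb ∨ ∃ qd ∈ d, vle qd (vsup qb qc)) :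
    ∃ sv : SymVec n, uf sv = uf ({qa}, b) ∪ uf ({qc}, d) := by
  refine ⟨({qa}, {q | vle qa q ∧ q ∉ uf ({qa}, b) ∪ uf ({qc}, d)}), Set.ext fun q' => ⟨?_, ?_⟩⟩
  · rintro ⟨hq, hmin⟩
    by_contra hnot
    exact hmin q' ⟨hq qa rfl, hnot⟩ fun _ => le_rfl
  · intro hq'
    have hqa : vle qa q' := by
      rcases hq' with hq' | hq'
      · exact hq'.1 qa rfl
      · exact vle_trans_s7 hac (hq'.1 qc rfl)
    refine ⟨by rintro _ rfl; exact hqa, ?_⟩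
    rintro q ⟨hq, hnot⟩ hle
    obtain ⟨qb, hqb, hqbq⟩ : ∃ qb ∈ b, vle qb q := by
      by_contra! hno
      exact hnot (Or.inl ⟨by rintro _ rfl; exact hq, hno⟩)
    rcases hq' with hq' | ⟨hc, hd⟩
    · exact hq'.2 qb hqb (vle_trans_s7 hqbq hle)
    · rcases hb qb hqb with hcb | ⟨qd, hqd, hle'⟩
      · refine hnot (Or.inr ⟨?_, fun qd hqd hdq => hd qd hqd (vle_trans_s7 hdq hle)⟩)
        rintro _ rfl
        exact vle_trans_s7 hcb hqbq
      · exact hd qd hqd (vle_trans_s7 hle' (vsup_vle (vle_trans_s7 hqbq hle) (hc qc rfl)))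

/-- Two mergeable canonical symbolic vectors can be merged into a single
symbolic vector with the union of their underlying sets. -/
theorem merge_singleton (sv sv' : SymVec n)
    (h : Canonical sv) (h' : Canonical sv') (hm : Mergeable sv sv') :
    ∃ sv'' : SymVec n, uf sv'' = uf sv ∪ uf sv' := by
  rcases hm with he | he | ⟨qa, qc, ha, hc, ⟨hac, hb⟩ | ⟨hca, hd⟩⟩
  · exact ⟨sv', by rw [he, Set.empty_union]⟩
  · exact ⟨sv, by rw [he, Set.union_empty]⟩
  · obtain ⟨a, b⟩ := sv
    obtain ⟨c, d⟩ := sv'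
    obtain rfl : a = {qa} := ha
    obtain rfl : c = {qc} := hc
    exact exists_uf_eq_union_of_vle hac hb
  · obtain ⟨a, b⟩ := sv
    obtain ⟨c, d⟩ := sv'
    obtain rfl : a = {qa} := ha
    obtain rfl : c = {qc} := hc
    rw [Set.union_comm]
    exact exists_uf_eq_union_of_vle hca hd
end

section
/- For canonical symbolic vectors sv and sv': overlap(sv, sv') holds if and only if uf(sv) ∩ uf(sv') ≠ ∅. -/
variable {n : ℕ}

theorem vle.trans {q r s : Vec n} (hqr : vle q r) (hrs : vle r s) : vle q s :=
  fun p => (hqr p).trans (hrs p)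

theorem vle.antisymm {q r : Vec n} (hqr : vle q r) (hrq : vle r q) : q = r :=
  funext fun p => (hqr p).antisymm (hrq p)

theorem vle_vsup_left (q r : Vec n) : vle q (vsup q r) := fun _ => le_max_left _ _

theorem vle_vsup_right (q r : Vec n) : vle r (vsup q r) := fun _ => le_max_right _ _

theorem vsup_vle_s8 {q r s : Vec n} (hq : vle q s) (hr : vle r s) : vle (vsup q r) s :=
  fun p => max_le (hq p) (hr p)

/-- The second disjunct in the overlap condition is subsumed by the first. -/
theorem not_vle_or_strict_iff {q r : Vec n} :
    ¬ vle q r ∨ (vle r q ∧ r ≠ q) ↔ ¬ vle q r :=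
  ⟨fun h hle => h.elim (· hle) fun hlt => hlt.2 (hlt.1.antisymm hle), Or.inl⟩

/-- Overlap iff nonempty intersection of the underlying sets. -/
theorem overlap_iff_inter_nonempty (sv sv' : SymVec n)
    (h : Canonical sv) (h' : Canonical sv') :
    Overlap sv sv' ↔ uf sv ∩ uf sv' ≠ ∅ := by
  obtain ⟨qa, ha, -⟩ := h
  obtain ⟨qc, hc, -⟩ := h'
  rw [← Set.nonempty_iff_ne_empty]
  constructor
  · rintro ⟨qa, qc, ha, hc, hb, hd⟩
    refine ⟨vsup qa qc, ⟨?_, ?_⟩, ⟨?_, ?_⟩⟩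
    · simpa [ha] using vle_vsup_left qa qc
    · exact fun q hq => not_vle_or_strict_iff.1 (hb q hq)
    · simpa [hc] using vle_vsup_right qa qc
    · exact fun q hq => not_vle_or_strict_iff.1 (hd q hq)
  · rintro ⟨q, ⟨haq, hb⟩, ⟨hcq, hd⟩⟩
    have hsup : vle (vsup qa qc) q := vsup_vle_s8 (haq qa (by simp [ha])) (hcq qc (by simp [hc]))
    exact ⟨qa, qc, ha, hc,
      fun r hr => Or.inl fun hle => hb r hr (hle.trans hsup),
      fun r hr => Or.inl fun hle => hd r hr (hle.trans hsup)⟩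
end

section
/- For canonical symbolic vectors sv and sv': if shareable(sv, sv') does not hold, then overlap(sv, sv') does not hold. -/
variable {n : ℕ}

theorem lexLe_of_not_lexLe {q q' : Vec n} (h : ¬ lexLe q q') : lexLe q' q := by
  have hne : ∃ p, q p ≠ q' p := Function.ne_iff.mp fun he => h (Or.inl he)
  obtain ⟨p, hp, hmin⟩ := WellFounded.has_min (wellFounded_lt (α := Fin n)) {p | q p ≠ q' p} hne
  have heq : ∀ p', p' < p → q p' = q' p' := fun p' hp' => by
    by_contra hc
    exact hmin p' hc hp'
  rcases lt_or_gt_of_ne hp with hlt | hgt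
  · exact absurd (Or.inr ⟨p, hlt, heq⟩) h
  · exact Or.inr ⟨p, hgt, fun p' hp' => (heq p' hp').symm⟩

theorem OverlapCore.shareableCore {qa qc : Vec n} {b d : Set (Vec n)}
    (h : OverlapCore qa b qc d) : ShareableCore qa b qc d := by
  have hb : ∀ qb ∈ b, ¬ vle qb (vsup qa qc) := fun qb hqb hle =>
    (h.1 qb hqb).elim (· hle) fun hlt => hlt.2 (vle_antisymm hlt.1 hle)
  have hd : ∀ qd ∈ d, ¬ vle qd (vsup qa qc) := fun qd hqd hle =>
    (h.2 qd hqd).elim (· hle) fun hlt => hlt.2 (vle_antisymm hlt.1 hle)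
  by_cases hlex : lexLe qa qc
  · exact Or.inl ⟨hlex, fun qb hqb hlt => hb qb hqb hlt.1, hd⟩
  · exact Or.inr ⟨lexLe_of_not_lexLe hlex, fun he => hlex (Or.inl he.symm),
      fun qd hqd hlt => hd qd hqd hlt.1, hb⟩

/-- Non-shareable canonical symbolic vectors do not overlap. -/
theorem not_shareable_not_overlap (sv sv' : SymVec n)
    (h : Canonical sv) (h' : Canonical sv') (hs : ¬ Shareable sv sv') :
    ¬ Overlap sv sv' := by
  rintro ⟨qa, qc, ha, hc, hcore⟩
  exact hs (Or.inr (Or.inr ⟨qa, qc, ha, hc, hcore.shareableCore⟩))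
end

section
/- For canonical symbolic vectors sv = ({q_a}, b) and sv' = ({q_c}, d), both with nonempty underlying sets: if mergeable(sv, sv') holds then gap(sv, sv') does not hold. -/
variable {n : ℕ}

/-- If the underlying set of `({q}, s)` is nonempty, no element of `s` lies below `q`. -/
theorem not_vle_of_uf_ne_empty {q : Vec n} {s : Set (Vec n)}
    (hne : uf (({q}, s) : SymVec n) ≠ ∅) : ∀ r ∈ s, ¬ vle r q := by
  obtain ⟨x, hx, hxs⟩ := Set.nonempty_iff_ne_empty.mpr hne
  exact fun r hr hrq => hxs r hr fun p => (hrq p).trans (hx q rfl p)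

theorem vsup_eq_right {q q' : Vec n} (h : vle q q') : vsup q q' = q' :=
  funext fun p => max_eq_right (h p)

theorem vsup_comm (q q' : Vec n) : vsup q q' = vsup q' q :=
  funext fun p => max_comm (q p) (q' p)

theorem GapCore.symm {qa qc : Vec n} {b d : Set (Vec n)} (hg : GapCore qa b qc d) :
    GapCore qc d qa b := by
  unfold GapCore at *
  rw [vsup_comm qc qa]
  rcases hg with hb | hd | ⟨hb, hd⟩
  exacts [.inr (.inl hb), .inl hd, .inr (.inr ⟨hd, hb⟩)]

/-- The asymmetric half of `mergeable_not_gap`, where `qa` lies below `qc`. -/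
theorem not_gapCore_of_vle {qa qc : Vec n} {b d : Set (Vec n)}
    (hd : ∀ qd ∈ d, ¬ vle qd qc) (hac : vle qa qc)
    (hb : ∀ qb ∈ b, vle qc qb ∨ ∃ qd ∈ d, vle qd (vsup qb qc)) :
    ¬ GapCore qa b qc d := by
  unfold GapCore
  rw [vsup_eq_right hac]
  rintro (⟨qb, hqb, hle, hne⟩ | ⟨qd, hqd, hle, -⟩ | ⟨-, hqc⟩)
  · rcases hb qb hqb with hcb | ⟨qd, hqd, hle'⟩
    · exact hne (vle_antisymm hle hcb)
    · exact hd qd hqd (vsup_eq_right hle ▸ hle')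
  · exact hd qd hqd hle
  · exact hd qc hqc fun _ => le_rfl

/-- Mergeable canonical symbolic vectors (with nonempty underlying sets) have
no gap. -/
theorem mergeable_not_gap (qa qc : Vec n) (b d : Set (Vec n))
    (h : Canonical (({qa}, b) : SymVec n)) (h' : Canonical (({qc}, d) : SymVec n))
    (hne : uf (({qa}, b) : SymVec n) ≠ ∅) (hne' : uf (({qc}, d) : SymVec n) ≠ ∅)
    (hm : MergeableCore qa b qc d) :
    ¬ GapCore qa b qc d := by
  rcases hm with ⟨hac, hb⟩ | ⟨hca, hd⟩
  · exact not_gapCore_of_vle (not_vle_of_uf_ne_empty hne') hac hb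
  · exact fun hg => not_gapCore_of_vle (not_vle_of_uf_ne_empty hne) hca hd hg.symm
end

section
/- Non-partial decomposition: let svs and svs' be two canonical symbolic vector sets with uf_svs(svs) = uf_svs(svs') and this common underlying set nonempty. Then for every subset S strictly contained in svs' with at least 2 elements, there is no sv ∈ svs such that sv ∉ S, uf(sv) ⊆ ⋃_{sv' ∈ S} uf(sv'), and overlap(sv, sv') holds for every sv' ∈ S. -/
variable {n : ℕ}

theorem lexLe_iff_toLex_le {q q' : Vec n} : lexLe q q' ↔ toLex q ≤ toLex q' := by
  rw [le_iff_eq_or_lt]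
  refine or_congr toLex_inj.symm ⟨?_, ?_⟩
  · rintro ⟨p, h, h'⟩
    exact ⟨p, h', h⟩
  · rintro ⟨p, h', h⟩
    exact ⟨p, h, h'⟩

theorem toLex_le_of_vle {q q' : Vec n} (h : vle q q') : toLex q ≤ toLex q' :=
  Pi.toLex_monotone h

theorem vsup_le {q q' r : Vec n} (h : vle q r) (h' : vle q' r) : vle (vsup q q') r :=
  fun p => max_le (h p) (h' p)

theorem vle_trans_s14 {q r s : Vec n} (h : vle q r) (h' : vle r s) : vle q s :=
  fun p => (h p).trans (h' p)

theorem mem_uf_of_vle {sv : SymVec n} {a x y : Vec n} (ha : sv.1 = {a}) (hx : x ∈ uf sv)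
    (hay : vle a y) (hyx : vle y x) : y ∈ uf sv := by
  refine ⟨fun q hq => ?_, fun q hq h => hx.2 q hq (vle_trans_s14 h hyx)⟩
  rw [ha, Set.mem_singleton_iff] at hq
  exact hq ▸ hay

theorem vle_of_mem_uf {sv : SymVec n} {a x : Vec n} (ha : sv.1 = {a}) (hx : x ∈ uf sv) :
    vle a x :=
  hx.1 a (by simp [ha])

theorem least_mem_uf {sv : SymVec n} {a : Vec n} (ha : sv.1 = {a}) (hne : uf sv ≠ ∅) :
    a ∈ uf sv := by
  obtain ⟨x, hx⟩ := Set.nonempty_iff_ne_empty.2 hne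
  exact mem_uf_of_vle ha hx (fun _ => le_rfl) (vle_of_mem_uf ha hx)

/-- The upper bounds of a canonical symbolic vector are determined by its least element and its
underlying set. -/
theorem Canonical.snd_subset {P Q : SymVec n} (hP : Canonical P) (hQ : Canonical Q) {a : Vec n}
    (ha : P.1 = {a}) (ha' : Q.1 = {a}) (h : uf P = uf Q) : P.2 ⊆ Q.2 := by
  have key : ∀ {P Q : SymVec n}, Canonical P → P.1 = {a} → Q.1 = {a} → uf P = uf Q →
      ∀ q ∈ P.2, ∃ q' ∈ Q.2, vle q' q := by
    intro P Q hP ha ha' h q hq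
    by_contra! hcon
    obtain ⟨a₀, ha₀, -, -, hle⟩ := hP
    obtain rfl : a = a₀ := Set.singleton_injective (ha.symm.trans ha₀)
    have hmem : q ∈ uf Q := ⟨fun r hr => by
      rw [ha', Set.mem_singleton_iff] at hr
      exact hr ▸ hle q hq, hcon⟩
    rw [← h] at hmem
    exact hmem.2 q hq fun _ => le_rfl
  intro q hq
  obtain ⟨q', hq', hle⟩ := key hP ha ha' h q hq
  obtain ⟨q'', hq'', hle'⟩ := key hQ ha' ha h.symm q' hq'
  obtain ⟨-, -, -, hanti, -⟩ := hP
  have : q'' = q := by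
    by_contra hne
    exact (hanti q'' hq'' q hq hne).1 (vle_trans_s14 hle' hle)
  subst this
  rwa [vle_antisymm hle' hle]

theorem CanonicalSVS.uf_ne_empty {svs : Set (SymVec n)} (hc : CanonicalSVS svs)
    {P : SymVec n} (hP : P ∈ svs) : uf P ≠ ∅ := by
  intro hemp
  rcases hc.2.1 with ⟨Q, hQ, hne⟩ | h
  · exact hc.2.2 P hP Q hQ (fun h => hne (h ▸ hemp)) (Or.inl hemp)
  · simp [h] at hP

/-- Distinct members of a canonical symbolic vector set have disjoint underlying sets. -/
theorem CanonicalSVS.eq_of_mem {svs : Set (SymVec n)} (hc : CanonicalSVS svs)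
    {P Q : SymVec n} (hP : P ∈ svs) (hQ : Q ∈ svs) {x : Vec n} (hxP : x ∈ uf P)
    (hxQ : x ∈ uf Q) : P = Q := by
  by_contra hne
  obtain ⟨a, ha, -⟩ := hc.1 P hP
  obtain ⟨c, hca, -⟩ := hc.1 Q hQ
  have hm : vle (vsup a c) x := vsup_le (vle_of_mem_uf ha hxP) (vle_of_mem_uf hca hxQ)
  have hb : ∀ q ∈ P.2, ¬ vle q (vsup a c) := fun q hq h => hxP.2 q hq (vle_trans_s14 h hm)
  have hd : ∀ q ∈ Q.2, ¬ vle q (vsup a c) := fun q hq h => hxQ.2 q hq (vle_trans_s14 h hm)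
  refine hc.2.2 P hP Q hQ hne (Or.inr (Or.inr ⟨a, c, ha, hca, ?_⟩))
  rcases le_or_gt (toLex a) (toLex c) with h | h
  · exact Or.inl ⟨lexLe_iff_toLex_le.2 h, fun q hq h => hb q hq h.1, hd⟩
  · exact Or.inr ⟨lexLe_iff_toLex_le.2 h.le, fun e => h.ne (congrArg toLex e),
      fun q hq h => hd q hq h.1, hb⟩

/-- Members `P`, `Q` of two canonical sets with the same least element `a` satisfy
`uf P ⊆ uf Q`, provided the members with lexicographically smaller least element agree. -/
theorem CanonicalSVS.uf_subset {svs svs' : Set (SymVec n)} (hc : CanonicalSVS svs)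
    (hc' : CanonicalSVS svs') (hsub : ufSvs svs ⊆ ufSvs svs') {P Q : SymVec n} (hP : P ∈ svs)
    (hQ : Q ∈ svs') {a : Vec n} (ha : P.1 = {a}) (ha' : Q.1 = {a})
    (ih : ∀ R ∈ svs', ∀ c, R.1 = {c} → toLex c < toLex a → R ∈ svs) : uf P ⊆ uf Q := by
  intro x
  induction x using WellFoundedLT.induction with
  | ind x hmin =>
  intro hx
  by_contra hxQ
  obtain ⟨R, hR, hxR⟩ := Set.mem_iUnion₂.1 (hsub (Set.mem_biUnion hP hx))
  have hRQ : Q ≠ R := fun h => hxQ (h ▸ hxR)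
  obtain ⟨c, hcR, -⟩ := hc'.1 R hR
  have hax := vle_of_mem_uf ha hx
  have hcx := vle_of_mem_uf hcR hxR
  have haQ := least_mem_uf ha' (hc'.uf_ne_empty hQ)
  have hlt : ∀ y, vle a y → vle y x → y ≠ x → y ∈ uf Q := fun y hay hyx hne =>
    hmin y (lt_of_le_of_ne hyx hne) (mem_uf_of_vle ha hx hay hyx)
  have hac : toLex a ≤ toLex c := by
    by_contra! h
    obtain rfl := hc.eq_of_mem hP (ih R hR c hcR h) hx hxR
    exact h.ne (congrArg toLex (Set.singleton_injective (hcR.symm.trans ha)))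
  have hm : vsup a c = x := by
    by_contra hne
    have hmx : vle (vsup a c) x := vsup_le hax hcx
    exact hRQ (hc'.eq_of_mem hQ hR (hlt _ (fun p => le_max_left _ _) hmx hne)
      (mem_uf_of_vle hcR hxR (fun p => le_max_right _ _) hmx))
  refine hc'.2.2 Q hQ R hR hRQ (Or.inr (Or.inr ⟨a, c, ha', hcR, Or.inl
    ⟨lexLe_iff_toLex_le.2 hac, ?_, ?_⟩⟩))
  · rintro q hq ⟨hqm, hne⟩
    rw [hm] at hqm hne
    obtain ⟨a₀, ha₀, -, -, hle⟩ := hc'.1 Q hQ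
    obtain rfl : a = a₀ := Set.singleton_injective (ha'.symm.trans ha₀)
    exact (hlt q (hle q hq) hqm hne).2 q hq fun _ => le_rfl
  · rw [hm]
    exact hxR.2

theorem CanonicalSVS.mem_of_forall_lt {svs svs' : Set (SymVec n)} (hc : CanonicalSVS svs)
    (hc' : CanonicalSVS svs') (heq : ufSvs svs = ufSvs svs') {a : Vec n}
    (ih : ∀ R ∈ svs, ∀ c, R.1 = {c} → toLex c < toLex a → R ∈ svs')
    (ih' : ∀ R ∈ svs', ∀ c, R.1 = {c} → toLex c < toLex a → R ∈ svs)
    {P : SymVec n} (hP : P ∈ svs) (ha : P.1 = {a}) : P ∈ svs' := by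
  have haP := least_mem_uf ha (hc.uf_ne_empty hP)
  obtain ⟨Q, hQ, haQ⟩ := Set.mem_iUnion₂.1 (heq ▸ Set.mem_biUnion hP haP : a ∈ ufSvs svs')
  obtain ⟨c, hcQ, -⟩ := hc'.1 Q hQ
  rcases (toLex_le_of_vle (vle_of_mem_uf hcQ haQ)).lt_or_eq with h | h
  · rwa [hc.eq_of_mem hP (ih' Q hQ c hcQ h) haP haQ]
  · obtain rfl := toLex_inj.1 h
    have huf : uf P = uf Q := (hc.uf_subset hc' heq.subset hP hQ ha hcQ ih').antisymm
      (hc'.uf_subset hc heq.symm.subset hQ hP hcQ ha ih)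
    have hb : P.2 = Q.2 := ((hc.1 P hP).snd_subset (hc'.1 Q hQ) ha hcQ huf).antisymm
      ((hc'.1 Q hQ).snd_subset (hc.1 P hP) hcQ ha huf.symm)
    rwa [Prod.ext (ha.trans hcQ.symm) hb]

/-- Canonical symbolic vector sets with the same underlying set are contained in each other. -/
theorem CanonicalSVS.subset_of_ufSvs_eq {svs svs' : Set (SymVec n)} (hc : CanonicalSVS svs)
    (hc' : CanonicalSVS svs') (heq : ufSvs svs = ufSvs svs') : svs ⊆ svs' := by
  have key : ∀ l : Lex (Vec n), (∀ R ∈ svs, R.1 = {ofLex l} → R ∈ svs') ∧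
      (∀ R ∈ svs', R.1 = {ofLex l} → R ∈ svs) := by
    intro l
    induction l using WellFoundedLT.induction with
    | ind l ih =>
    have h : ∀ R ∈ svs, ∀ c, R.1 = {c} → toLex c < l → R ∈ svs' :=
      fun R hR c hcR hlt => (ih (toLex c) hlt).1 R hR hcR
    have h' : ∀ R ∈ svs', ∀ c, R.1 = {c} → toLex c < l → R ∈ svs :=
      fun R hR c hcR hlt => (ih (toLex c) hlt).2 R hR hcR
    exact ⟨fun R hR hRl => hc.mem_of_forall_lt hc' heq h h' hR hRl,
      fun R hR hRl => hc'.mem_of_forall_lt hc heq.symm h' h hR hRl⟩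
  intro P hP
  obtain ⟨a, ha, -⟩ := hc.1 P hP
  exact (key (toLex a)).1 P hP ha

/-- Non-partial decomposition. -/
theorem non_partial_decomposition (svs svs' : Set (SymVec n))
    (hfin : svs.Finite) (hfin' : svs'.Finite)
    (hc : CanonicalSVS svs) (hc' : CanonicalSVS svs')
    (heq : ufSvs svs = ufSvs svs') (hne : ufSvs svs ≠ ∅) :
    ∀ S : Set (SymVec n), S ⊂ svs' → S.Nontrivial →
      ¬ ∃ sv ∈ svs, sv ∉ S ∧ uf sv ⊆ (⋃ sv' ∈ S, uf sv') ∧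
        ∀ sv' ∈ S, Overlap sv sv' := by
  rintro S hS - ⟨sv, hsv, hsvS, hsub, -⟩
  obtain ⟨x, hx⟩ := Set.nonempty_iff_ne_empty.2 (hc.uf_ne_empty hsv)
  obtain ⟨Q, hQ, hxQ⟩ := Set.mem_iUnion₂.1 (hsub hx)
  have := hc'.eq_of_mem (hc.subset_of_ufSvs_eq hc' heq hsv) (hS.subset hQ) hx hxQ
  exact hsvS (this ▸ hQ)
end

section
/- Non-inclusion: let svs and svs' be two canonical symbolic vector sets with uf_svs(svs) = uf_svs(svs') and this common underlying set nonempty. Then there do not exist sv ∈ svs and sv' ∈ svs' such that uf(sv) is strictly contained in uf(sv'). -/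
variable {n : ℕ}

theorem vle_iff_le (q q' : Vec n) : vle q q' ↔ q ≤ q' := Iff.rfl

theorem lexLe_of_toLex_le {q q' : Vec n} (h : toLex q ≤ toLex q') : lexLe q q' := by
  rcases h.eq_or_lt with h | h
  · exact Or.inl (toLex.injective h)
  · obtain ⟨p, hp, hlt⟩ := h
    exact Or.inr ⟨p, hlt, hp⟩

theorem mem_uf_iff {sv : SymVec n} {qa q : Vec n} (ha : sv.1 = {qa}) :
    q ∈ uf sv ↔ qa ≤ q ∧ ∀ qb ∈ sv.2, ¬ qb ≤ q := by
  simp [uf, ha, vle_iff_le]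

theorem mem_ufSvs_iff {S : Set (SymVec n)} {q : Vec n} :
    q ∈ ufSvs S ↔ ∃ sv ∈ S, q ∈ uf sv := by
  simp [ufSvs]

/-- A member of a canonical set has a least element, and its upper bounds form an antichain above
that least element. -/
theorem CanonicalSVS.exists_min {svs : Set (SymVec n)} (hc : CanonicalSVS svs) {sv : SymVec n}
    (hsv : sv ∈ svs) :
    ∃ qa, sv.1 = {qa} ∧ qa ∈ uf sv ∧
      (∀ qb ∈ sv.2, ∀ qb' ∈ sv.2, qb ≤ qb' → qb = qb') ∧ ∀ qb ∈ sv.2, qa ≤ qb := by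
  obtain ⟨hcan, hnonempty, hsh⟩ := hc
  have hne : uf sv ≠ ∅ := by
    intro hempty
    rcases hnonempty with ⟨sv₀, h₀, hne₀⟩ | rfl
    · exact hsh sv hsv sv₀ h₀ (fun h => hne₀ (h ▸ hempty)) (Or.inl hempty)
    · exact hsv
  obtain ⟨qa, ha, hmin, hanti, hle⟩ := hcan sv hsv
  refine ⟨qa, ha, ?_, fun qb hb qb' hb' h => ?_, hle⟩
  · rcases hmin with hmin | rfl
    · exact (mem_uf_iff ha).2 ⟨le_rfl, hmin⟩
    · refine absurd (Set.eq_empty_of_forall_notMem fun q hq => ?_) hne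
      exact hq.2 0 rfl fun p => Nat.zero_le _
  · by_contra hne'
    exact (hanti qb hb qb' hb' hne').1 h

/-- Non-shareability of distinct members, oriented by the lexicographic order of the minima. -/
theorem CanonicalSVS.exists_bound {svs : Set (SymVec n)} (hc : CanonicalSVS svs)
    {sv sv' : SymVec n} (hsv : sv ∈ svs) (hsv' : sv' ∈ svs) (hne : sv ≠ sv') {qa qc : Vec n}
    (ha : sv.1 = {qa}) (hc' : sv'.1 = {qc}) (hlex : toLex qa ≤ toLex qc) :
    (∃ qb ∈ sv.2, qb ≤ qa ⊔ qc ∧ qb ≠ qa ⊔ qc) ∨ ∃ qd ∈ sv'.2, qd ≤ qa ⊔ qc := by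
  by_contra hcon
  rw [not_or] at hcon
  exact hc.2.2 sv hsv sv' hsv' hne (Or.inr (Or.inr ⟨qa, qc, ha, hc', Or.inl
    ⟨lexLe_of_toLex_le hlex, fun qb hb h => hcon.1 ⟨qb, hb, h.1, h.2⟩,
      fun qd hd h => hcon.2 ⟨qd, hd, h⟩⟩⟩))

/-- If the minima of two distinct members are comparable, some bound of the smaller one lies
strictly below the larger minimum. -/
theorem CanonicalSVS.exists_bound_of_le {svs : Set (SymVec n)} (hc : CanonicalSVS svs)
    {sv sv' : SymVec n} (hsv : sv ∈ svs) (hsv' : sv' ∈ svs) (hne : sv ≠ sv') {qa qc : Vec n}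
    (ha : sv.1 = {qa}) (hc' : sv'.1 = {qc}) (hmem : qc ∈ uf sv') (hle : qa ≤ qc) :
    ∃ qb ∈ sv.2, qb ≤ qc := by
  have h := hc.exists_bound hsv hsv' hne ha hc' (Pi.toLex_monotone hle)
  rw [sup_eq_right.2 hle] at h
  rcases h with ⟨qb, hb, h, -⟩ | ⟨qd, hd, h⟩
  · exact ⟨qb, hb, h⟩
  · exact absurd h (((mem_uf_iff hc').1 hmem).2 qd hd)

/-- If the bound `qb` of a member belongs to another member whose minimum is `q₂`, then the minimum
`q₂` is lexicographically smaller and `qb` is the join of the two minima. -/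
theorem CanonicalSVS.lt_and_eq_sup_of_bound_mem {svs : Set (SymVec n)} (hc : CanonicalSVS svs)
    {sv sv₂ : SymVec n} (hsv : sv ∈ svs) (hsv₂ : sv₂ ∈ svs) {qa q₂ qb : Vec n}
    (ha : sv.1 = {qa}) (ha₂ : sv₂.1 = {q₂}) (hb : qb ∈ sv.2) (hmem : qb ∈ uf sv₂) :
    toLex q₂ < toLex qa ∧ qb = qa ⊔ q₂ := by
  have hne : sv ≠ sv₂ := by
    rintro rfl
    exact ((mem_uf_iff ha).1 hmem).2 qb hb le_rfl
  obtain ⟨qa', ha', -, hanti, hble⟩ := hc.exists_min hsv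
  obtain rfl : qa' = qa := Set.singleton_injective (ha'.symm.trans ha)
  rw [mem_uf_iff ha₂] at hmem
  have hsup : qa' ⊔ q₂ ≤ qb := sup_le (hble qb hb) hmem.1
  rcases le_or_gt (toLex qa') (toLex q₂) with hlex | hlex
  · rcases hc.exists_bound hsv hsv₂ hne ha ha₂ hlex with ⟨e, he, hle, hne'⟩ | ⟨d, hd, hle⟩
    · obtain rfl := hanti e he qb hb (hle.trans hsup)
      exact absurd (le_antisymm hle hsup) hne'
    · exact absurd (hle.trans hsup) (hmem.2 d hd)
  · refine ⟨hlex, ?_⟩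
    rcases hc.exists_bound hsv₂ hsv hne.symm ha₂ ha hlex.le with ⟨d, hd, hle, -⟩ | ⟨e, he, hle⟩
    · exact absurd ((sup_comm q₂ qa' ▸ hle).trans hsup) (hmem.2 d hd)
    · rw [sup_comm] at hle
      obtain rfl := hanti e he qb hb (hle.trans hsup)
      exact le_antisymm hle hsup

/-- If two canonical sets have the same underlying set and the minimum of a member `Y` of the
second belongs to a member `X` of the first, then `Y` is included in `X`. -/
theorem CanonicalSVS.uf_subset_of_min_mem (y : Lex (Vec n)) :
    ∀ {svs svs' : Set (SymVec n)}, CanonicalSVS svs → CanonicalSVS svs' → ufSvs svs = ufSvs svs' →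
      ∀ {X Y : SymVec n}, X ∈ svs → Y ∈ svs' → Y.1 = {ofLex y} → ofLex y ∈ uf X →
        uf Y ⊆ uf X := by
  induction y using WellFoundedLT.induction with
  | _ y ih =>
  intro svs svs' hc hc' heq X Y hX hY hy hyX q hqY
  by_contra hqX
  obtain ⟨qc, rfl⟩ : ∃ qc, toLex qc = y := ⟨ofLex y, rfl⟩
  simp only [ofLex_toLex] at hy hyX
  obtain ⟨qa, ha, haX, -, -⟩ := hc.exists_min hX
  obtain ⟨qc', hy', hcY, -, -⟩ := hc'.exists_min hY
  obtain rfl : qc' = qc := Set.singleton_injective (hy'.symm.trans hy)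
  have hac : qa ≤ qc' := ((mem_uf_iff ha).1 hyX).1
  obtain ⟨Y₁, hY₁, haY₁⟩ := mem_ufSvs_iff.1 (heq ▸ mem_ufSvs_iff.2 ⟨X, hX, haX⟩)
  obtain ⟨q₁, h₁, hq₁, -, -⟩ := hc'.exists_min hY₁
  rcases hac.eq_or_lt with rfl | hlt
  · obtain ⟨hyq, hdq⟩ := (mem_uf_iff hy).1 hqY
    obtain ⟨qb, hb, hbq⟩ : ∃ qb ∈ X.2, qb ≤ q := by
      by_contra hcon
      exact hqX ((mem_uf_iff ha).2 ⟨hyq, fun qb hb h => hcon ⟨qb, hb, h⟩⟩)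
    obtain ⟨qa', ha', -, -, hble⟩ := hc.exists_min hX
    obtain rfl : qa' = qa := Set.singleton_injective (ha'.symm.trans ha)
    have hbY : qb ∈ uf Y := (mem_uf_iff hy).2 ⟨hble qb hb, fun d hd h => hdq d hd (h.trans hbq)⟩
    obtain ⟨X₂, hX₂, hbX₂⟩ := mem_ufSvs_iff.1 (heq ▸ mem_ufSvs_iff.2 ⟨Y, hY, hbY⟩)
    obtain ⟨q₂, h₂, hq₂, -, -⟩ := hc.exists_min hX₂
    obtain ⟨hlex, hsup⟩ := hc.lt_and_eq_sup_of_bound_mem hX hX₂ ha h₂ hb hbX₂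
    obtain ⟨Y₂, hY₂, hqY₂⟩ := mem_ufSvs_iff.1 (heq ▸ mem_ufSvs_iff.2 ⟨X₂, hX₂, hq₂⟩)
    obtain ⟨r, hr, hrY₂, -, -⟩ := hc'.exists_min hY₂
    have hrq : r ≤ q₂ := ((mem_uf_iff hr).1 hqY₂).1
    have hne : Y₂ ≠ Y := by
      rintro rfl
      exact hlex.not_ge (Pi.toLex_monotone ((mem_uf_iff hy).1 hqY₂).1)
    have hsub := ih (toLex q₂) hlex hc' hc heq.symm hY₂ hX₂ h₂ hqY₂
    have hrb : r ⊔ qa' ≤ qb := by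
      rw [hsup, sup_comm]
      exact sup_le_sup_left hrq _
    rcases hc'.exists_bound hY₂ hY hne hr hy ((Pi.toLex_monotone hrq).trans hlex.le) with
      ⟨e, he, hle, -⟩ | ⟨d, hd, hle⟩
    · exact ((mem_uf_iff hr).1 (hsub hbX₂)).2 e he (hle.trans hrb)
    · exact ((mem_uf_iff hy).1 hbY).2 d hd (hle.trans hrb)
  · have hqa : q₁ ≤ qa := ((mem_uf_iff h₁).1 haY₁).1
    have hne : Y₁ ≠ Y := by
      rintro rfl
      exact hlt.not_ge ((mem_uf_iff hy).1 haY₁).1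
    obtain ⟨d, hd, hle⟩ := hc'.exists_bound_of_le hY₁ hY hne h₁ hy hcY (hqa.trans hac)
    have hsub := ih (toLex qa) (Pi.toLex_strictMono hlt) hc' hc heq.symm hY₁ hX ha haY₁
    exact ((mem_uf_iff h₁).1 (hsub hyX)).2 d hd hle

/-- Non-inclusion. -/
theorem non_inclusion (svs svs' : Set (SymVec n))
    (hfin : svs.Finite) (hfin' : svs'.Finite)
    (hc : CanonicalSVS svs) (hc' : CanonicalSVS svs')
    (heq : ufSvs svs = ufSvs svs') (hne : ufSvs svs ≠ ∅) :
    ¬ ∃ sv ∈ svs, ∃ sv' ∈ svs', uf sv ⊂ uf sv' := by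
  rintro ⟨sv, hsv, sv', hsv', hsub, hnot⟩
  obtain ⟨qa, ha, hqa, -, -⟩ := hc.exists_min hsv
  obtain ⟨qc, hqc, hcmem, -, -⟩ := hc'.exists_min hsv'
  obtain ⟨X, hX, hcX⟩ := mem_ufSvs_iff.1 (heq ▸ mem_ufSvs_iff.2 ⟨sv', hsv', hcmem⟩)
  have hincl := CanonicalSVS.uf_subset_of_min_mem (toLex qc) hc hc' heq hX hsv' hqc hcX
  obtain ⟨x, hx, -, -, -⟩ := hc.exists_min hX
  have hne : X ≠ sv := by
    rintro rfl
    exact hnot hincl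
  have haX := (mem_uf_iff hx).1 (hincl (hsub hqa))
  obtain ⟨d, hd, hle⟩ := hc.exists_bound_of_le hX hsv hne hx ha hqa haX.1
  exact haX.2 d hd hle
end

section
/- Normalisation of exclusion bounds: for any vectors q_a, q_b and any set of vectors b, uf(({q_a}, b ∪ {q_b})) = uf(({q_a}, b ∪ {q_a ⊔ q_b})), where q_a ⊔ q_b is the componentwise maximum of q_a and q_b. -/
variable {n : ℕ}

/-- The join of two vectors lies below a vector iff both vectors do. -/
theorem vsup_vle_iff (q q' r : Vec n) : vle (vsup q q') r ↔ vle q r ∧ vle q' r := by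
  simp only [vle, vsup, max_le_iff, forall_and]

/-- Normalisation of exclusion bounds. -/
theorem uf_normalise_exclusion (qa qb : Vec n) (b : Set (Vec n)) :
    uf (({qa}, b ∪ {qb}) : SymVec n) = uf (({qa}, b ∪ {vsup qa qb}) : SymVec n) := by
  ext q
  simp only [uf, Set.mem_ofPred_eq, Set.mem_singleton_iff, forall_eq, Set.mem_union, or_imp,
    forall_and, vsup_vle_iff]
  tauto
end
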